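/- Let α > n, 0 < p < 2(n−1)/(n+α−2), 0 < t < 2n/(n+α), θ = 1/(p−1), κ = t′−1, s₁ = n+α−2−(n−α)/(p−1), s₂ = (α−n)t′+2n, and let (u, v) be a pair of positive Lebesgue measurable solutions (with the integrability normalization of the paper) of the system u(y) = ∫_{ℝ^n_+} v^κ(x) |x−y|^{α−n} |x−x^o|^{−s₂} dx for y ∈ ∂ℝ^n_+ and v(x) = ∫_{∂ℝ^n_+} u^θ(y) |x−y|^{α−n} |y−x^o|^{−s₁} dy for x ∈ ℝ^n_+. Then there exists Λ < 0 such that for every λ ≤ Λ: u(y) ≥ u_λ(y) for all y ∈ Σ_{λ,n−1}, and v(x) ≥ v_λ(x) for all x ∈ Σ_{λ,n}. -/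

import Mathlib

noncomputable section

open MeasureTheory Metric ENNReal

/-- `ℝ^n` with the Euclidean norm. -/
abbrev Eu (n : ℕ) : Type := EuclideanSpace ℝ (Fin n)

/-- The last coordinate `x_n` of a point `x ∈ ℝ^n`. -/
def lastCoord (n : ℕ) (x : Eu n) : ℝ :=
  if h : 0 < n then x ⟨n - 1, Nat.sub_lt h Nat.one_pos⟩ else 0

/-- The first coordinate `x_1` of a point `x ∈ ℝ^n`. -/
def firstCoord (n : ℕ) (x : Eu n) : ℝ :=
  if h : 0 < n then x ⟨0, h⟩ else 0

/-- The open upper half space `ℝ^n_+ = {x : x_n > 0}`. -/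
def upperHalf (n : ℕ) : Set (Eu n) := {x | 0 < lastCoord n x}

/-- The identification of `ℝ^{n-1}` with the boundary `∂ℝ^n_+ = {x : x_n = 0}`. -/
def emb (n : ℕ) (y : Eu (n - 1)) : Eu n :=
  (EuclideanSpace.equiv (Fin n) ℝ).symm fun i =>
    if h : (i : ℕ) < n - 1 then y ⟨i, h⟩ else 0

/-- The point `z^o = (0,…,0,-1) ∈ ℝ^n`. -/
def zo (n : ℕ) : Eu n :=
  (EuclideanSpace.equiv (Fin n) ℝ).symm fun i => if (i : ℕ) = n - 1 then -1 else 0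

/-- The point `x^o = (0,…,0,-2) ∈ ℝ^n`. -/
def xo (n : ℕ) : Eu n :=
  (EuclideanSpace.equiv (Fin n) ℝ).symm fun i => if (i : ℕ) = n - 1 then -2 else 0

/-- The surface measure on the sphere `∂B^n = {x : |x - z^o| = 1}`. -/
def surf (n : ℕ) : Measure (Eu n) :=
  Measure.map (fun p : sphere (0 : Eu n) 1 => zo n + (p : Eu n))
    (volume : Measure (Eu n)).toSphere

/-- Lebesgue measure restricted to the open unit ball `B^n` centered at `z^o`. -/
def ballM (n : ℕ) : Measure (Eu n) := (volume : Measure (Eu n)).restrict (ball (zo n) 1)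

/-- `ω_n`, the volume of the unit ball in `ℝ^n`. -/
def unitBallVol (n : ℕ) : ℝ := ((volume : Measure (Eu n)) (ball (0 : Eu n) 1)).toReal

/-- `(∫ F^r)^{1/r}` (in `ℝ≥0∞`) of a nonnegative function `F`, for an arbitrary
nonzero real exponent `r`. -/
def eLp {X : Type*} [MeasurableSpace X] (μ : Measure X) (f : X → ℝ) (r : ℝ) : ℝ≥0∞ :=
  (∫⁻ x, ENNReal.ofReal (f x) ^ r ∂μ) ^ (1 / r)

/-- `(∫ F^r)^{1/r}` (in `ℝ≥0∞`) of an `ℝ≥0∞`-valued function `F`. -/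
def eLpE {X : Type*} [MeasurableSpace X] (μ : Measure X) (F : X → ℝ≥0∞) (r : ℝ) : ℝ≥0∞ :=
  (∫⁻ x, F x ^ r ∂μ) ^ (1 / r)

/-- The real `L^r`-norm `(∫ |f|^r)^{1/r}`. -/
def rLp {X : Type*} [MeasurableSpace X] (μ : Measure X) (f : X → ℝ) (r : ℝ) : ℝ :=
  (∫ x, |f x| ^ r ∂μ) ^ (1 / r)

/-- The sharp constant `C_{e1}(n,α)`. -/
def Ce1 (n : ℕ) (α : ℝ) : ℝ :=
  ((n : ℝ) * unitBallVol n) ^ (-(((n : ℝ) + α - 2) / (2 * ((n : ℝ) - 1)))) *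
    (∫ ξ in ball (zo n) 1,
        (∫ ζ, ‖ξ - ζ‖ ^ (α - (n : ℝ)) ∂surf n) ^ (2 * (n : ℝ) / ((n : ℝ) - α))) ^
      (((n : ℝ) - α) / (2 * (n : ℝ)))

/-- The sharp constant `C_{e2}(n,α)`. -/
def Ce2 (n : ℕ) (α : ℝ) : ℝ :=
  ((n : ℝ) * unitBallVol n) ^ (-(((n : ℝ) + α - 4) / (2 * ((n : ℝ) - 1)))) *
    (∫ ξ in ball (zo n) 1,
        (∫ ζ, (1 - ‖ξ - zo n‖ ^ 2) * ‖ξ - ζ‖ ^ (-((n : ℝ) - α + 2)) ∂surf n) ^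
          (2 * (n : ℝ) / ((n : ℝ) - α))) ^ (((n : ℝ) - α) / (2 * (n : ℝ)))

/-- Reflection `x ↦ x_λ = (2λ - x_1, x_2, …, x_m)` across the hyperplane
`{x_1 = λ}`. -/
def reflFst (m : ℕ) (l : ℝ) (x : Eu m) : Eu m :=
  (EuclideanSpace.equiv (Fin m) ℝ).symm fun i => if (i : ℕ) = 0 then 2 * l - x i else x i


/-- Radial majorant. -/
def psi (b q r : ℝ) : ℝ := if r ≤ 1 then r ^ (b - 1) else r ^ (-q)

lemma psi_nonneg {b q r : ℝ} (hr : 0 ≤ r) : 0 ≤ psi b q r := by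
  unfold psi; split_ifs <;> positivity

lemma psi_measurable (b q : ℝ) : Measurable (psi b q) := by
  unfold psi
  refine Measurable.ite (measurableSet_le measurable_id measurable_const) ?_ ?_ <;> fun_prop

lemma psi_anti {b q r s : ℝ} (hb : b ≤ 1) (hq : 0 ≤ q) (hr : 0 < r) (hrs : r ≤ s) :
    psi b q s ≤ psi b q r := by
  unfold psi
  split_ifs with h1 h2 h2
  · exact Real.rpow_le_rpow_of_nonpos hr hrs (by linarith)
  · exact absurd (hrs.trans h1) h2
  · push Not at h1
    calc s ^ (-q) ≤ 1 := Real.rpow_le_one_of_one_le_of_nonpos h1.le (by linarith)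
      _ ≤ r ^ (b - 1) := Real.one_le_rpow_of_pos_of_le_one_of_nonpos hr h2 (by linarith)
  · exact Real.rpow_le_rpow_of_nonpos hr hrs (by linarith)

lemma pow_diff_lower {a P Q : ℝ} (ha : 0 < a) (hQ : 0 ≤ Q) (hQP : Q ≤ P) (hP : 0 < P) :
    min 1 (a / 2) * (P ^ (a - 2) * (P ^ 2 - Q ^ 2)) ≤ P ^ a - Q ^ a := by
  set s := (Q / P) ^ 2 with hs
  have hr0 : 0 ≤ Q / P := by positivity
  have hr1 : Q / P ≤ 1 := by rw [div_le_one hP]; exact hQP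
  have hs0 : 0 ≤ s := by positivity
  have hs1 : s ≤ 1 := by rw [hs]; exact pow_le_one₀ hr0 hr1
  have hsa : (Q / P) ^ a = s ^ (a / 2) := by
    rw [hs, ← Real.rpow_natCast, ← Real.rpow_mul hr0]; congr 1; push_cast; ring
  have e1 : P ^ a - Q ^ a = P ^ a * (1 - s ^ (a / 2)) := by
    rw [← hsa, Real.div_rpow hQ hP.le]
    have : P ^ a ≠ 0 := by positivity
    field_simp
  have e2 : P ^ (a - 2) * (P ^ 2 - Q ^ 2) = P ^ a * (1 - s) := by
    have : P ^ a = P ^ (a - 2) * P ^ 2 := by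
      rw [← Real.rpow_natCast P 2, ← Real.rpow_add hP]; congr 1; push_cast; ring
    rw [this, hs]; field_simp
  rw [e1, e2]
  have key : min 1 (a / 2) * (1 - s) ≤ 1 - s ^ (a / 2) := by
    rcases le_total 1 (a / 2) with h | h
    · rw [min_eq_left h]
      have := Real.rpow_le_rpow_of_exponent_ge' hs0 hs1 zero_le_one h
      rw [Real.rpow_one] at this; linarith
    · rw [min_eq_right h]
      have := rpow_one_add_le_one_add_mul_self (s := s - 1) (by linarith) (by positivity) h
      rw [show 1 + (s - 1) = s by ring] at this
      nlinarith
  nlinarith [Real.rpow_pos_of_pos hP a]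

lemma pow_diff_upper {a P Q : ℝ} (ha : 0 < a) (hQ : 0 ≤ Q) (hQP : Q ≤ P) (hP : 0 < P) :
    P ^ a - Q ^ a ≤ max 1 (a / 2) * (P ^ (a - 2) * (P ^ 2 - Q ^ 2)) := by
  set s := (Q / P) ^ 2 with hs
  have hr0 : 0 ≤ Q / P := by positivity
  have hr1 : Q / P ≤ 1 := by rw [div_le_one hP]; exact hQP
  have hs0 : 0 ≤ s := by positivity
  have hs1 : s ≤ 1 := by rw [hs]; exact pow_le_one₀ hr0 hr1
  have hsa : (Q / P) ^ a = s ^ (a / 2) := by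
    rw [hs, ← Real.rpow_natCast, ← Real.rpow_mul hr0]; congr 1; push_cast; ring
  have e1 : P ^ a - Q ^ a = P ^ a * (1 - s ^ (a / 2)) := by
    rw [← hsa, Real.div_rpow hQ hP.le]
    have : P ^ a ≠ 0 := by positivity
    field_simp
  have e2 : P ^ (a - 2) * (P ^ 2 - Q ^ 2) = P ^ a * (1 - s) := by
    have : P ^ a = P ^ (a - 2) * P ^ 2 := by
      rw [← Real.rpow_natCast P 2, ← Real.rpow_add hP]; congr 1; push_cast; ring
    rw [this, hs]; field_simp
  rw [e1, e2]
  have key : 1 - s ^ (a / 2) ≤ max 1 (a / 2) * (1 - s) := by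
    rcases le_total 1 (a / 2) with h | h
    · rw [max_eq_right h]
      have := one_add_mul_self_le_rpow_one_add (s := s - 1) (by linarith) h
      rw [show 1 + (s - 1) = s by ring] at this
      nlinarith
    · rw [max_eq_left h]
      have := Real.rpow_le_rpow_of_exponent_ge' hs0 hs1 (by positivity) h
      rw [Real.rpow_one] at this; linarith
  nlinarith [Real.rpow_pos_of_pos hP a]

lemma core_bound {a N X Q Y m : ℝ} (ha : 0 < a) (hN : 1 ≤ N) (hX : 1 ≤ X) (hQ : 0 < Q)
    (hm0 : 0 ≤ m) (hmQ : m ≤ Q) (hmX : m ≤ X) (hYX : Y ≤ X + Q) (hQY : Q ≤ X + Y) (hY : 1 ≤ Y) :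
    X ^ (-(2 * N + a)) * ((Y / Q) ^ (2 - a) * m) ≤
      (4 + 2 * 2 ^ a) * (psi (min a 1) (2 * N + min a 1 - 1) X
        + psi (min a 1) (2 * N + min a 1 - 1) Q) := by
  have hX0 : 0 < X := by linarith
  have hY0 : 0 < Y := by linarith
  have hpX : X ^ (-(2 * N + min a 1 - 1)) ≤ psi (min a 1) (2 * N + min a 1 - 1) X := by
    unfold psi; split_ifs with h
    · have : X = 1 := le_antisymm h hX
      rw [this]; simp
    · exact le_rfl
  have hpQ0 := psi_nonneg (b := min a 1) (q := 2 * N + min a 1 - 1) hQ.le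
  have hpX0 := psi_nonneg (b := min a 1) (q := 2 * N + min a 1 - 1) hX0.le
  have h2a : (0 : ℝ) < 2 ^ a := by positivity
  have hYQ : Y / Q ≤ 1 + X / Q := by
    rw [div_le_iff₀ hQ]; field_simp; linarith
  have hYQ0 : 0 < Y / Q := by positivity
  -- it suffices to bound by X ^ a
  have suff1 : 1 ≤ a → (Y / Q) ^ (2 - a) * m ≤ (4 + 2 * 2 ^ a) * X ^ a →
      X ^ (-(2 * N + a)) * ((Y / Q) ^ (2 - a) * m) ≤
      (4 + 2 * 2 ^ a) * (psi (min a 1) (2 * N + min a 1 - 1) X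
        + psi (min a 1) (2 * N + min a 1 - 1) Q) := by
    intro h1 h
    have e : X ^ (-(2 * N + a)) * X ^ a = X ^ (-(2 * N + min a 1 - 1)) := by
      rw [← Real.rpow_add hX0, min_eq_right h1]; congr 1; ring
    calc X ^ (-(2 * N + a)) * ((Y / Q) ^ (2 - a) * m)
        ≤ X ^ (-(2 * N + a)) * ((4 + 2 * 2 ^ a) * X ^ a) := by gcongr
      _ = (4 + 2 * 2 ^ a) * (X ^ (-(2 * N + a)) * X ^ a) := by ring
      _ ≤ _ := by rw [e]; gcongr; linarith
  rcases le_or_gt 2 a with h2 | h2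
  · apply suff1 (by linarith)
    have hQYd : Q / Y ≤ 2 * X := by
      rw [div_le_iff₀ hY0]; nlinarith
    have e : (Y / Q) ^ (2 - a) = (Q / Y) ^ (a - 2) := by
      rw [← inv_div, Real.inv_rpow (by positivity), ← Real.rpow_neg (by positivity)]; congr 1; ring
    have : (Y / Q) ^ (2 - a) * m ≤ (2 * X) ^ a := by
      calc (Y / Q) ^ (2 - a) * m ≤ (2 * X) ^ (a - 2) * (2 * X) := by
            rw [e]
            apply mul_le_mul _ (by linarith) hm0 (by positivity)
            exact Real.rpow_le_rpow (by positivity) hQYd (by linarith)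
        _ = (2 * X) ^ (a - 1) := by
            rw [← Real.rpow_add_one (by positivity)]; congr 1; ring
        _ ≤ (2 * X) ^ a := Real.rpow_le_rpow_of_exponent_le (by linarith) (by linarith)
    rw [Real.mul_rpow (by norm_num) hX0.le] at this
    have : 0 ≤ X ^ a := by positivity
    nlinarith
  rcases le_or_gt 1 a with h1 | h1
  · apply suff1 h1
    have h3 : (Y / Q) ^ (2 - a) ≤ 1 + X / Q := by
      calc (Y / Q) ^ (2 - a) ≤ (1 + X / Q) ^ (2 - a) :=
            Real.rpow_le_rpow hYQ0.le hYQ (by linarith)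
        _ ≤ (1 + X / Q) ^ (1 : ℝ) := Real.rpow_le_rpow_of_exponent_le
            (by have : 0 < X / Q := by positivity
                linarith) (by linarith)
        _ = _ := Real.rpow_one _
    have h4 : (1 + X / Q) * m ≤ 2 * X := by
      have : X / Q * m ≤ X := by
        rw [div_mul_eq_mul_div, div_le_iff₀ hQ]; nlinarith
      linarith
    have h5 : X ≤ X ^ a := by
      calc X = X ^ (1 : ℝ) := (Real.rpow_one _).symm
        _ ≤ X ^ a := Real.rpow_le_rpow_of_exponent_le hX h1
    have h6 : (Y / Q) ^ (2 - a) * m ≤ (1 + X / Q) * m := by gcongr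
    nlinarith
  · have hmin : min a 1 = a := min_eq_left h1.le
    rw [hmin] at hpX hpQ0 hpX0 ⊢
    rcases le_or_gt X Q with hXQ | hXQ
    · have h3 : (Y / Q) ^ (2 - a) ≤ 4 := by
        have h7 : Y / Q ≤ 2 := by rw [div_le_iff₀ hQ]; linarith
        calc (Y / Q) ^ (2 - a) ≤ 2 ^ (2 - a) := Real.rpow_le_rpow hYQ0.le h7 (by linarith)
          _ ≤ 2 ^ (2 : ℝ) := Real.rpow_le_rpow_of_exponent_le (by norm_num) (by linarith)
          _ = 4 := by norm_num
      have e : X ^ (-(2 * N + a)) * X = X ^ (-(2 * N + a - 1)) := by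
        rw [← Real.rpow_add_one hX0.ne']; congr 1; ring
      calc X ^ (-(2 * N + a)) * ((Y / Q) ^ (2 - a) * m) ≤ X ^ (-(2 * N + a)) * (4 * X) := by gcongr
        _ = 4 * (X ^ (-(2 * N + a)) * X) := by ring
        _ ≤ _ := by
          rw [e]; nlinarith
    · have h3 : (Y / Q) ^ (2 - a) * m ≤ 4 * (X ^ (2 - a) * Q ^ (a - 1)) := by
        have h7 : Y / Q ≤ 2 * (X / Q) := by
          rw [div_le_iff₀ hQ]; field_simp; linarith
        calc (Y / Q) ^ (2 - a) * m ≤ (2 * (X / Q)) ^ (2 - a) * Q := by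
              apply mul_le_mul _ hmQ hm0 (by positivity)
              exact Real.rpow_le_rpow hYQ0.le h7 (by linarith)
          _ = 2 ^ (2 - a) * (X ^ (2 - a) * Q ^ (a - 1)) := by
              rw [Real.mul_rpow (by norm_num) (by positivity), Real.div_rpow hX0.le hQ.le,
                show a - 1 = 1 - (2 - a) by ring, Real.rpow_sub hQ 1 (2 - a), Real.rpow_one]
              ring
          _ ≤ 2 ^ (2 : ℝ) * (X ^ (2 - a) * Q ^ (a - 1)) := by
              gcongr
              · norm_num
              · linarith
          _ = _ := by norm_num
      have e : X ^ (-(2 * N + a)) * X ^ (2 - a) = X ^ (2 - 2 * N - 2 * a) := by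
        rw [← Real.rpow_add hX0]; congr 1; ring
      have h8 : X ^ (2 - 2 * N - 2 * a) * Q ^ (a - 1) ≤ psi a (2 * N + a - 1) Q := by
        unfold psi; split_ifs with h
        · have : X ^ (2 - 2 * N - 2 * a) ≤ 1 :=
            Real.rpow_le_one_of_one_le_of_nonpos hX (by linarith)
          exact mul_le_of_le_one_left (by positivity) this
        · calc X ^ (2 - 2 * N - 2 * a) * Q ^ (a - 1)
              ≤ Q ^ (2 - 2 * N - 2 * a) * Q ^ (a - 1) := by
                gcongr ?_ * _
                exact Real.rpow_le_rpow_of_nonpos hQ hXQ.le (by linarith)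
            _ = Q ^ (-(2 * N + a - 1)) := by
                rw [← Real.rpow_add hQ]; congr 1; ring
      calc X ^ (-(2 * N + a)) * ((Y / Q) ^ (2 - a) * m)
          ≤ X ^ (-(2 * N + a)) * (4 * (X ^ (2 - a) * Q ^ (a - 1))) := by gcongr
        _ = 4 * (X ^ (-(2 * N + a)) * X ^ (2 - a) * Q ^ (a - 1)) := by ring
        _ ≤ _ := by rw [e]; nlinarith

lemma pow_compare {a P Y : ℝ} (hY : 0 < Y) (h1 : Y / 2 ≤ P) (h2 : P ≤ 2 * Y) :
    2 ^ (-|a - 2|) * Y ^ (a - 2) ≤ P ^ (a - 2) := by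
  have hP : 0 < P := by linarith
  rcases le_total 2 a with h | h
  · rw [abs_of_nonneg (by linarith)]
    calc (2 : ℝ) ^ (-(a - 2)) * Y ^ (a - 2) = (Y / 2) ^ (a - 2) := by
          rw [Real.div_rpow hY.le (by norm_num), Real.rpow_neg (by norm_num)]; ring
      _ ≤ _ := Real.rpow_le_rpow (by positivity) h1 (by linarith)
  · rw [abs_of_nonpos (by linarith), neg_neg]
    rw [← Real.mul_rpow (by norm_num) hY.le]
    exact Real.rpow_le_rpow_of_nonpos hP h2 (by linarith)

/-- constant in the good region -/
def cOne (a : ℝ) : ℝ := 2 * min 1 (a / 2) * 2 ^ (-|a - 2|)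
/-- constant in the bad region -/
def cTwo (a : ℝ) : ℝ := 4 * max 1 (a / 2) * (4 + 2 * 2 ^ a)

lemma cOne_pos {a : ℝ} (ha : 0 < a) : 0 < cOne a := by
  unfold cOne
  have : 0 < min 1 (a / 2) := lt_min one_pos (by positivity)
  positivity

lemma cTwo_pos (a : ℝ) : 0 < cTwo a := by
  unfold cTwo
  have : 0 < max 1 (a / 2) := lt_max_of_lt_left one_pos
  positivity

lemma pointwise_key {a N f M x1 l d P Q X Y : ℝ} (ha : 0 < a) (hN : 1 ≤ N) (hf : 0 ≤ f)
    (hM : 0 ≤ M) (hfM : 2 ≤ X → f ≤ M * X ^ (-(2 * N + a))) (hl : l ≤ -2) (hd : 0 ≤ d)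
    (hP : 0 ≤ P) (hQ : 0 ≤ Q) (hPQ : P ^ 2 - Q ^ 2 = 4 * (x1 - l) * d)
    (hQm : l - x1 ≤ Q) (hQXY : Q ≤ X + Y) (hYXP : Y ≤ X + P) (hPXY : P ≤ X + Y)
    (hY : -l ≤ Y) (hX : |x1| ≤ X) :
    f * Q ^ a + (if X ≤ 1 then f * (cOne a * (-l) * d * Y ^ (a - 2)) else 0) ≤
      f * P ^ a + cTwo a * M * d * Y ^ (a - 2) *
        (psi (min a 1) (2 * N + min a 1 - 1) X + psi (min a 1) (2 * N + min a 1 - 1) Q) := by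
  have hY0 : 0 < Y := by linarith
  have hX0 : 0 ≤ X := (abs_nonneg _).trans hX
  have hpQ0 := psi_nonneg (b := min a 1) (q := 2 * N + min a 1 - 1) hQ
  have hpX0 := psi_nonneg (b := min a 1) (q := 2 * N + min a 1 - 1) hX0
  have hc2 := cTwo_pos a
  have hR : 0 ≤ cTwo a * M * d * Y ^ (a - 2) *
        (psi (min a 1) (2 * N + min a 1 - 1) X + psi (min a 1) (2 * N + min a 1 - 1) Q) := by
    positivity
  have hx := abs_le.1 hX
  split_ifs with h1
  · have hP0 : 0 < P := by linarith
    have hx1 : -l / 2 ≤ x1 - l := by linarith [hx.1]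
    have hsq : 2 * (-l) * d ≤ P ^ 2 - Q ^ 2 := by rw [hPQ]; nlinarith
    have hQP : Q ≤ P := by
      apply (pow_le_pow_iff_left₀ hQ hP two_ne_zero).1
      nlinarith
    have k1 := pow_diff_lower ha hQ hQP hP0
    have k2 := pow_compare (a := a) hY0 (by linarith : Y / 2 ≤ P) (by linarith)
    have hmin : 0 < min 1 (a / 2) := lt_min one_pos (by positivity)
    have k3 : cOne a * (-l) * d * Y ^ (a - 2) ≤ P ^ a - Q ^ a := by
      refine le_trans ?_ k1
      calc cOne a * (-l) * d * Y ^ (a - 2)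
          = min 1 (a / 2) * ((2 ^ (-|a - 2|) * Y ^ (a - 2)) * (2 * (-l) * d)) := by
            unfold cOne; ring
        _ ≤ _ := by
            have : 0 ≤ 2 * (-l) * d := by
              have : 0 ≤ -l := by linarith
              positivity
            gcongr
    nlinarith
  · rcases le_or_gt l x1 with h2 | h2
    · have hQP : Q ≤ P := by
        apply (pow_le_pow_iff_left₀ hQ hP two_ne_zero).1
        have : 0 ≤ 4 * (x1 - l) * d := by
          have : 0 ≤ x1 - l := by linarith
          positivity
        linarith
      have : f * Q ^ a ≤ f * P ^ a := by gcongr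
      linarith
    · have hm : 0 < l - x1 := by linarith
      have hQ0 : 0 < Q := by linarith
      have hPQ' : P ≤ Q := by
        apply (pow_le_pow_iff_left₀ hP hQ two_ne_zero).1
        have : 0 ≤ 4 * (l - x1) * d := by positivity
        linarith
      have hX2 : 2 ≤ X := by linarith [hx.1]
      have k1 := pow_diff_upper ha hP hPQ' hQ0
      have k2 := core_bound (m := l - x1) ha hN (by linarith : 1 ≤ X) hQ0 hm.le hQm
        (by linarith [hx.1]) (by linarith : Y ≤ X + Q) hQXY (by linarith)
      have e : Q ^ (a - 2) = Y ^ (a - 2) * (Y / Q) ^ (2 - a) := by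
        rw [show 2 - a = -(a - 2) by ring, Real.rpow_neg (by positivity),
          Real.div_rpow hY0.le hQ]
        field_simp
      have k3 : f * (Q ^ a - P ^ a) ≤ cTwo a * M * d * Y ^ (a - 2) *
        (psi (min a 1) (2 * N + min a 1 - 1) X + psi (min a 1) (2 * N + min a 1 - 1) Q) := by
        have hmax : 0 < max 1 (a / 2) := lt_max_of_lt_left one_pos
        calc f * (Q ^ a - P ^ a)
            ≤ (M * X ^ (-(2 * N + a))) *
              (max 1 (a / 2) * (Q ^ (a - 2) * (Q ^ 2 - P ^ 2))) := by
              apply mul_le_mul (hfM hX2) k1 _ (by positivity)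
              have : P ^ a ≤ Q ^ a := by gcongr
              linarith
          _ = 4 * max 1 (a / 2) * M * d * Y ^ (a - 2) *
              (X ^ (-(2 * N + a)) * ((Y / Q) ^ (2 - a) * (l - x1))) := by
              rw [show Q ^ 2 - P ^ 2 = 4 * (l - x1) * d by linarith, e]; ring
          _ ≤ 4 * max 1 (a / 2) * M * d * Y ^ (a - 2) * _ :=
              mul_le_mul_of_nonneg_left k2 (by positivity)
          _ = _ := by unfold cTwo; ring
      nlinarith

lemma psi_lintegral (N : ℕ) (hN : 1 ≤ N) (b q : ℝ) (hb : 0 < b) (hq : (N : ℝ) < q) :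
    (∫⁻ x : Eu N, ENNReal.ofReal (psi b q ‖x‖)) ≠ ⊤ := by
  have : Nonempty (Fin N) := ⟨⟨0, hN⟩⟩
  have : Nontrivial (Eu N) := inferInstance
  have hN' : (1 : ℝ) ≤ N := by exact_mod_cast hN
  have : Integrable (fun x : Eu N => psi b q ‖x‖) := by
    rw [integrable_fun_norm_addHaar (volume : Measure (Eu N)) (f := psi b q)]
    rw [← Set.Ioc_union_Ioi_eq_Ioi (zero_le_one (α := ℝ))]
    have hfr : ((Module.finrank ℝ (Eu N) - 1 : ℕ) : ℝ) = N - 1 := by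
      simp [Nat.cast_sub hN]
    refine IntegrableOn.union ?_ ?_
    · have h : IntegrableOn (fun r : ℝ => r ^ ((N : ℝ) + b - 2)) (Set.Ioc 0 1) := by
        rw [← intervalIntegrable_iff_integrableOn_Ioc_of_le zero_le_one]
        exact intervalIntegral.intervalIntegrable_rpow' (by linarith)
      refine h.congr_fun ?_ measurableSet_Ioc
      intro r hr
      simp only [psi, if_pos hr.2, smul_eq_mul]
      rw [← Real.rpow_natCast, hfr, ← Real.rpow_add hr.1]; congr 1; ring
    · have h : IntegrableOn (fun r : ℝ => r ^ ((N : ℝ) - 1 - q)) (Set.Ioi 1) :=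
        integrableOn_Ioi_rpow_of_lt (by linarith) one_pos
      refine h.congr_fun ?_ measurableSet_Ioi
      intro r hr
      have hr' : (1 : ℝ) < r := hr
      simp only [psi, if_neg (not_le.2 hr'), smul_eq_mul]
      rw [← Real.rpow_natCast, hfr, ← Real.rpow_add (by linarith)]; congr 1
  have h2 := this.lintegral_lt_top
  exact h2.ne

lemma psi_lintegral_shift (N : ℕ) (b q : ℝ) (z : Eu N) :
    (∫⁻ x : Eu N, ENNReal.ofReal (psi b q ‖x - z‖)) =
      ∫⁻ x : Eu N, ENNReal.ofReal (psi b q ‖x‖) :=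
  lintegral_sub_right_eq_self (fun x : Eu N => ENNReal.ofReal (psi b q ‖x‖)) z

lemma refl_sq (n : ℕ) (hn : 1 ≤ n) (l : ℝ) (x w : Eu n) :
    ‖x - w‖ ^ 2 - ‖x - reflFst n l w‖ ^ 2
      = 4 * (firstCoord n x - l) * (l - firstCoord n w) := by
  obtain ⟨k, rfl⟩ : ∃ k, n = k + 1 := ⟨n - 1, by omega⟩
  rw [EuclideanSpace.norm_sq_eq, EuclideanSpace.norm_sq_eq, Fin.sum_univ_succ, Fin.sum_univ_succ]
  simp [reflFst, firstCoord]
  ring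

lemma firstCoord_refl (n : ℕ) (hn : 1 ≤ n) (l : ℝ) (w : Eu n) :
    firstCoord n (reflFst n l w) = 2 * l - firstCoord n w := by
  obtain ⟨k, rfl⟩ : ∃ k, n = k + 1 := ⟨n - 1, by omega⟩
  simp [reflFst, firstCoord]

lemma abs_firstCoord_le (n : ℕ) (hn : 1 ≤ n) (x : Eu n) : |firstCoord n x| ≤ ‖x‖ := by
  unfold firstCoord
  rw [dif_pos (by omega)]
  exact PiLp.norm_apply_le x _

lemma firstCoord_sub (n : ℕ) (x y : Eu n) :
    firstCoord n (x - y) = firstCoord n x - firstCoord n y := by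
  unfold firstCoord
  split_ifs <;> simp

theorem moving_abstract {Ω : Type*} [MeasurableSpace Ω] (μ : Measure Ω) (n : ℕ) (hn : 1 ≤ n)
    (φ : Ω → Eu n) (hφ : Measurable φ) (f : Ω → ℝ) (hfm : Measurable f)
    (a N M K i0 : ℝ) (ha : 0 < a) (hN : 1 ≤ N) (hM : 0 ≤ M) (hK0 : 0 ≤ K) (hi0 : 0 < i0)
    (hf : ∀ᵐ x ∂μ, 0 ≤ f x ∧ (2 ≤ ‖φ x‖ → f x ≤ M * ‖φ x‖ ^ (-(2 * N + a))))
    (hi : ENNReal.ofReal i0 ≤ ∫⁻ x in {x | ‖φ x‖ ≤ 1}, ENNReal.ofReal (f x) ∂μ)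
    (hK : ∀ z, (∫⁻ x, ENNReal.ofReal (psi (min a 1) (2 * N + min a 1 - 1) ‖φ x - z‖) ∂μ)
      ≤ ENNReal.ofReal K) :
    ∃ Λ : ℝ, Λ < 0 ∧ ∀ l : ℝ, l ≤ Λ → ∀ w : Eu n, firstCoord n w ≤ l →
      (∫⁻ x, ENNReal.ofReal (f x * ‖φ x - reflFst n l w‖ ^ a) ∂μ) ≤
        ∫⁻ x, ENNReal.ofReal (f x * ‖φ x - w‖ ^ a) ∂μ := by
  have hc1 := cOne_pos ha
  have hc2 := cTwo_pos a
  refine ⟨-max 2 (cTwo a * M * (2 * K) / (cOne a * i0)), ?_, ?_⟩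
  · have := le_max_left 2 (cTwo a * M * (2 * K) / (cOne a * i0)); linarith
  intro l hl w hw
  have hl2 : l ≤ -2 := by
    have := le_max_left 2 (cTwo a * M * (2 * K) / (cOne a * i0)); linarith
  have hlK : cTwo a * M * (2 * K) ≤ cOne a * (-l) * i0 := by
    have := le_max_right 2 (cTwo a * M * (2 * K) / (cOne a * i0))
    have h : cTwo a * M * (2 * K) / (cOne a * i0) ≤ -l := by linarith
    rw [div_le_iff₀ (by positivity)] at h
    linarith
  set d := l - firstCoord n w with hd
  have hd0 : 0 ≤ d := by linarith
  set Y := ‖w‖ with hYdef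
  set w' := reflFst n l w with hw'
  have hY : -l ≤ Y := by
    have := abs_le.1 (abs_firstCoord_le n hn w)
    linarith [this.1]
  have hY0 : 0 < Y := by linarith
  have hwY : ‖w'‖ ≤ Y := by
    have h := refl_sq n hn l 0 w
    have h0 : firstCoord n (0 : Eu n) = 0 := by unfold firstCoord; split_ifs <;> simp
    rw [h0] at h
    simp only [zero_sub, norm_neg] at h
    apply (pow_le_pow_iff_left₀ (norm_nonneg _) (norm_nonneg _) two_ne_zero).1
    have : 0 ≤ 4 * -l * d := by
      have : 0 ≤ -l := by linarith
      positivity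
    linarith
  set A := d * Y ^ (a - 2) with hA
  have hA0 : 0 ≤ A := by positivity
  set ψ := psi (min a 1) (2 * N + min a 1 - 1) with hψ
  have hψm : Measurable ψ := psi_measurable _ _
  have hl0 : 0 ≤ -l := by linarith
  have hB : MeasurableSet {x | ‖φ x‖ ≤ 1} := measurableSet_le hφ.norm measurable_const
  have hfm' : Measurable fun x => ENNReal.ofReal (f x) := hfm.ennreal_ofReal
  have main : ∀ᵐ x ∂μ,
      ENNReal.ofReal (f x * ‖φ x - w'‖ ^ a) +
        {x | ‖φ x‖ ≤ 1}.indicator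
          (fun x => ENNReal.ofReal (cOne a * (-l) * A) * ENNReal.ofReal (f x)) x ≤
      ENNReal.ofReal (f x * ‖φ x - w‖ ^ a) +
        ENNReal.ofReal (cTwo a * M * A) *
          (ENNReal.ofReal (ψ ‖φ x - 0‖) + ENNReal.ofReal (ψ ‖φ x - w'‖)) := by
    filter_upwards [hf] with x hx
    have hpx : 0 ≤ ψ ‖φ x‖ := psi_nonneg (norm_nonneg _)
    have hpw : 0 ≤ ψ ‖φ x - w'‖ := psi_nonneg (norm_nonneg _)
    have hf0 := hx.1
    have key := pointwise_key (x1 := firstCoord n (φ x)) (P := ‖φ x - w‖) (Q := ‖φ x - w'‖)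
      (X := ‖φ x‖) (Y := Y) (d := d) ha hN hx.1 hM hx.2 hl2 hd0 (norm_nonneg _) (norm_nonneg _)
      (refl_sq n hn l (φ x) w)
      (by
        have h1 := abs_le.1 (abs_firstCoord_le n hn (φ x - w'))
        rw [firstCoord_sub, firstCoord_refl n hn] at h1
        linarith [h1.1])
      ((norm_sub_le _ _).trans (by linarith))
      (by
        have := norm_sub_norm_le w (φ x)
        rw [norm_sub_rev] at this
        linarith)
      (norm_sub_le _ _) hY (abs_firstCoord_le n hn (φ x))
    have e1 : {x | ‖φ x‖ ≤ 1}.indicator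
          (fun x => ENNReal.ofReal (cOne a * (-l) * A) * ENNReal.ofReal (f x)) x
        = ENNReal.ofReal (if ‖φ x‖ ≤ 1 then f x * (cOne a * (-l) * d * Y ^ (a - 2)) else 0) := by
      by_cases h : ‖φ x‖ ≤ 1
      · rw [Set.indicator_of_mem (by exact h), if_pos h, ← ENNReal.ofReal_mul (by positivity)]
        congr 1; rw [hA]; ring
      · rw [Set.indicator_of_notMem (by exact h), if_neg h, ENNReal.ofReal_zero]
    rw [e1, sub_zero, ← ENNReal.ofReal_add hpx hpw, ← ENNReal.ofReal_mul (by positivity),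
      ← ENNReal.ofReal_add (by positivity) (by split_ifs <;> positivity),
      ← ENNReal.ofReal_add (by positivity) (by positivity)]
    apply ENNReal.ofReal_le_ofReal
    have e2 : cTwo a * M * A = cTwo a * M * d * Y ^ (a - 2) := by rw [hA]; ring
    rw [e2]
    exact key
  have hInt0 := lintegral_mono_ae main
  rw [lintegral_add_left (by fun_prop), lintegral_add_left (by fun_prop),
    lintegral_indicator hB, lintegral_const_mul _ hfm', lintegral_const_mul _ (by fun_prop),
    lintegral_add_left (by fun_prop)] at hInt0
  set R := ENNReal.ofReal (cTwo a * M * A) * (ENNReal.ofReal K + ENNReal.ofReal K) with hR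
  have hRtop : R ≠ ⊤ := by
    rw [hR]; exact ENNReal.mul_ne_top ENNReal.ofReal_ne_top (by simp)
  have hRle : R ≤ ENNReal.ofReal (cOne a * (-l) * A) *
      ∫⁻ x in {x | ‖φ x‖ ≤ 1}, ENNReal.ofReal (f x) ∂μ := by
    refine le_trans ?_ (mul_le_mul_right hi _)
    rw [hR, ← ENNReal.ofReal_add hK0 hK0, ← ENNReal.ofReal_mul (by positivity),
      ← ENNReal.ofReal_mul (by positivity)]
    apply ENNReal.ofReal_le_ofReal
    nlinarith
  have h3 : ENNReal.ofReal (cTwo a * M * A) *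
      ((∫⁻ x, ENNReal.ofReal (ψ ‖φ x - 0‖) ∂μ) + ∫⁻ x, ENNReal.ofReal (ψ ‖φ x - w'‖) ∂μ) ≤ R :=
    mul_le_mul_right (add_le_add (hK 0) (hK w')) _
  have h4 := ((add_le_add le_rfl hRle).trans hInt0).trans (add_le_add le_rfl h3)
  exact (ENNReal.add_le_add_iff_right hRtop).1 h4

lemma lower_abstract {Ω : Type*} [MeasurableSpace Ω] (μ : Measure Ω) (n : ℕ)
    (φ : Ω → Eu n) (hφ : Measurable φ) (f : Ω → ℝ) (hfm : Measurable f)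
    (a i0 : ℝ) (ha : 0 < a) (hi0 : 0 < i0) (hf : ∀ᵐ x ∂μ, 0 ≤ f x)
    (hi : ENNReal.ofReal i0 ≤ ∫⁻ x in {x | ‖φ x‖ ≤ 1}, ENNReal.ofReal (f x) ∂μ)
    (w : Eu n) (hw : 2 ≤ ‖w‖) :
    ENNReal.ofReal (i0 * (‖w‖ / 2) ^ a) ≤ ∫⁻ x, ENNReal.ofReal (f x * ‖φ x - w‖ ^ a) ∂μ := by
  have hB : MeasurableSet {x | ‖φ x‖ ≤ 1} := measurableSet_le hφ.norm measurable_const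
  calc ENNReal.ofReal (i0 * (‖w‖ / 2) ^ a)
      = ENNReal.ofReal i0 * ENNReal.ofReal ((‖w‖ / 2) ^ a) := ENNReal.ofReal_mul hi0.le
    _ ≤ (∫⁻ x in {x | ‖φ x‖ ≤ 1}, ENNReal.ofReal (f x) ∂μ) * ENNReal.ofReal ((‖w‖ / 2) ^ a) :=
        mul_le_mul_left hi _
    _ = ∫⁻ x in {x | ‖φ x‖ ≤ 1}, ENNReal.ofReal (f x) * ENNReal.ofReal ((‖w‖ / 2) ^ a) ∂μ :=
        (lintegral_mul_const _ hfm.ennreal_ofReal).symm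
    _ ≤ ∫⁻ x in {x | ‖φ x‖ ≤ 1}, ENNReal.ofReal (f x * ‖φ x - w‖ ^ a) ∂μ := by
        apply setLIntegral_mono_ae (by fun_prop)
        filter_upwards [hf] with x hx hxB
        rw [← ENNReal.ofReal_mul hx]
        apply ENNReal.ofReal_le_ofReal
        have hxB' : ‖φ x‖ ≤ 1 := hxB
        have : ‖w‖ / 2 ≤ ‖φ x - w‖ := by
          have := norm_sub_norm_le w (φ x)
          rw [norm_sub_rev] at this
          linarith
        gcongr
    _ ≤ _ := setLIntegral_le_lintegral _ _

lemma exists_real_le {I : ℝ≥0∞} (h : 0 < I) : ∃ i0 : ℝ, 0 < i0 ∧ ENNReal.ofReal i0 ≤ I := by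
  refine ⟨(min I 1).toReal, ?_, ?_⟩
  · apply ENNReal.toReal_pos
    · exact (lt_min h one_pos).ne'
    · exact ne_top_of_le_ne_top ENNReal.one_ne_top (min_le_right _ _)
  · rw [ENNReal.ofReal_toReal (ne_top_of_le_ne_top ENNReal.one_ne_top (min_le_right _ _))]
    exact min_le_left _ _

lemma emb_continuous (n : ℕ) : Continuous (emb n) := by
  unfold emb
  refine (EuclideanSpace.equiv (Fin n) ℝ).symm.continuous.comp ?_
  refine continuous_pi fun i => ?_
  split_ifs <;> fun_prop

lemma lastCoord_continuous (n : ℕ) : Continuous (lastCoord n) := by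
  unfold lastCoord
  split_ifs <;> fun_prop

lemma upperHalf_open (n : ℕ) : IsOpen (upperHalf n) :=
  isOpen_lt continuous_const (lastCoord_continuous n)

lemma emb_norm (n : ℕ) (hn : 1 ≤ n) (y : Eu (n - 1)) : ‖emb n y‖ = ‖y‖ := by
  obtain ⟨k, rfl⟩ : ∃ k, n = k + 1 := ⟨n - 1, by omega⟩
  rw [EuclideanSpace.norm_eq, EuclideanSpace.norm_eq, Fin.sum_univ_castSucc]
  simp [emb]

lemma emb_last (n : ℕ) (y : Eu (n - 1)) : lastCoord n (emb n y) = 0 := by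
  unfold lastCoord emb
  split_ifs <;> simp

lemma emb_proj (n : ℕ) (hn : 1 ≤ n) (z : Eu n) :
    ∃ z' : Eu (n - 1), ∀ y, ‖y - z'‖ ≤ ‖emb n y - z‖ := by
  obtain ⟨k, rfl⟩ : ∃ k, n = k + 1 := ⟨n - 1, by omega⟩
  refine ⟨WithLp.toLp 2 fun i : Fin k => z i.castSucc, fun y => ?_⟩
  rw [EuclideanSpace.norm_eq, EuclideanSpace.norm_eq, Fin.sum_univ_castSucc]
  apply Real.sqrt_le_sqrt
  simp only [emb]
  simp
  positivity

lemma upper_sq (n : ℕ) (hn : 1 ≤ n) (x : Eu n) :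
    ‖x - xo n‖ ^ 2 = ‖x‖ ^ 2 + 4 * lastCoord n x + 4 := by
  obtain ⟨k, rfl⟩ : ∃ k, n = k + 1 := ⟨n - 1, by omega⟩
  rw [EuclideanSpace.norm_sq_eq, EuclideanSpace.norm_sq_eq, Fin.sum_univ_castSucc,
    Fin.sum_univ_castSucc]
  have h : ∀ i : Fin k, (i : ℕ) ≠ k := fun i => i.2.ne
  have hl : (⟨k, Nat.lt_succ_self k⟩ : Fin (k + 1)) = Fin.last k := rfl
  simp [xo, lastCoord, h, hl]
  ring

lemma upper_norm (n : ℕ) (hn : 1 ≤ n) (x : Eu n) (hx : 0 ≤ lastCoord n x) :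
    ‖x‖ ≤ ‖x - xo n‖ := by
  apply (pow_le_pow_iff_left₀ (norm_nonneg _) (norm_nonneg _) two_ne_zero).1
  rw [upper_sq n hn]; linarith

lemma upper_norm_pos (n : ℕ) (hn : 1 ≤ n) (x : Eu n) (hx : 0 ≤ lastCoord n x) :
    0 < ‖x - xo n‖ := by
  have h := upper_sq n hn x
  rcases (norm_nonneg (x - xo n)).eq_or_lt' with h0 | h0
  · rw [h0] at h
    nlinarith [sq_nonneg ‖x‖]
  · exact h0

lemma upper_ball_nonempty (n : ℕ) (hn : 1 ≤ n) : (upperHalf n ∩ ball 0 1).Nonempty := by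
  obtain ⟨k, rfl⟩ : ∃ k, n = k + 1 := ⟨n - 1, by omega⟩
  refine ⟨EuclideanSpace.single (Fin.last k) (1 / 2 : ℝ), ?_, ?_⟩
  · have hl : (⟨k, Nat.lt_succ_self k⟩ : Fin (k + 1)) = Fin.last k := rfl
    simp [upperHalf, lastCoord, hl]
  · rw [mem_ball_zero_iff, EuclideanSpace.norm_single]; norm_num

lemma emb_first (n : ℕ) (hn : 2 ≤ n) (y : Eu (n - 1)) :
    firstCoord n (emb n y) = firstCoord (n - 1) y := by
  have h1 : 0 < n - 1 := by omega
  have h2 : 0 < n := by omega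
  simp [firstCoord, emb, h1, h2]

lemma emb_refl (n : ℕ) (hn : 2 ≤ n) (l : ℝ) (y : Eu (n - 1)) :
    emb n (reflFst (n - 1) l y) = reflFst n l (emb n y) := by
  ext i
  by_cases h : (i : ℕ) < n - 1
  · simp [emb, reflFst, h]
  · have h0 : (i : ℕ) ≠ 0 := by omega
    simp [emb, reflFst, h, h0]

lemma refl_mem (n : ℕ) (hn : 2 ≤ n) (l : ℝ) (x : Eu n) (hx : x ∈ upperHalf n) :
    reflFst n l x ∈ upperHalf n := by
  have h0 : n - 1 ≠ 0 := by omega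
  have h2 : 0 < n := by omega
  simp only [upperHalf, lastCoord, Set.mem_setOf_eq, dif_pos h2] at hx ⊢
  simpa [reflFst, h0] using hx

lemma decay_bound {X Z c a k s v : ℝ} (hX : 0 < X) (hc : 0 < c) (hk : k ≤ 0) (hs : 0 ≤ s)
    (hZ : X ≤ Z) (hv : c * (X / 2) ^ a ≤ v) :
    v ^ k * Z ^ (-s) ≤ (c / 2 ^ a) ^ k * X ^ (a * k - s) := by
  have h1 : v ^ k ≤ (c * (X / 2) ^ a) ^ k :=
    Real.rpow_le_rpow_of_nonpos (by positivity) hv hk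
  have h2 : Z ^ (-s) ≤ X ^ (-s) := Real.rpow_le_rpow_of_nonpos hX hZ (by linarith)
  have h3 : (c * (X / 2) ^ a) ^ k * X ^ (-s) = (c / 2 ^ a) ^ k * X ^ (a * k - s) := by
    rw [Real.div_rpow hX.le (by norm_num), show c * (X ^ a / 2 ^ a) = c / 2 ^ a * X ^ a by ring,
      Real.mul_rpow (by positivity) (by positivity), ← Real.rpow_mul hX.le, sub_eq_add_neg,
      Real.rpow_add hX]
    ring
  rw [← h3]
  have hZ0 : 0 < Z := by linarith
  gcongr

/-- Lemma 2.11, starting the moving plane method for positive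
solutions of the integral system on the upper half space. -/
theorem system_moving_plane_start
    (n : ℕ) (hn : 2 ≤ n) (α : ℝ) (hα : (n : ℝ) < α)
    (p t t' θ κ s₁ s₂ s₁' s₂' : ℝ)
    (hp0 : 0 < p) (hp : p < 2 * ((n : ℝ) - 1) / ((n : ℝ) + α - 2))
    (ht0 : 0 < t) (ht : t < 2 * (n : ℝ) / ((n : ℝ) + α))
    (ht' : t' = t / (t - 1))
    (hθ : θ = 1 / (p - 1)) (hκ : κ = t' - 1)
    (hs₁ : s₁ = (n : ℝ) + α - 2 - ((n : ℝ) - α) / (p - 1))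
    (hs₂ : s₂ = (α - (n : ℝ)) * t' + 2 * (n : ℝ))
    (hs₁' : s₁' = (n : ℝ) + α - 2 - 2 * ((n : ℝ) - 1) / p)
    (hs₂' : s₂' = (n : ℝ) + α - 2 * (n : ℝ) / t)
    (u : Eu (n - 1) → ℝ) (v : Eu n → ℝ)
    (hum : Measurable u) (hvm : Measurable v)
    (hu0 : ∀ y, 0 < u y) (hv0 : ∀ x ∈ upperHalf n, 0 < v x)
    (hu : ∀ y, ENNReal.ofReal (u y) =
      ∫⁻ x in upperHalf n,
        ENNReal.ofReal (v x ^ κ * ‖x - emb n y‖ ^ (α - (n : ℝ)) * ‖x - xo n‖ ^ (-s₂)))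
    (hv : ∀ x ∈ upperHalf n, ENNReal.ofReal (v x) =
      ∫⁻ y, ENNReal.ofReal (u y ^ θ * ‖x - emb n y‖ ^ (α - (n : ℝ)) * ‖emb n y - xo n‖ ^ (-s₁)))
    (huL : (∫⁻ y, ENNReal.ofReal ((u y * ‖emb n y - xo n‖ ^ (-s₁')) ^ (θ + 1))) ≠ ⊤)
    (hvL : (∫⁻ x in upperHalf n, ENNReal.ofReal ((v x * ‖x - xo n‖ ^ (-s₂')) ^ t')) ≠ ⊤)
    :
    ∃ Λ : ℝ, Λ < 0 ∧ ∀ l : ℝ, l ≤ Λ →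
      (∀ y : Eu (n - 1), firstCoord (n - 1) y ≤ l → u (reflFst (n - 1) l y) ≤ u y) ∧
      (∀ x ∈ upperHalf n, firstCoord n x ≤ l → v (reflFst n l x) ≤ v x) := by
  have hn' : (2 : ℝ) ≤ n := by exact_mod_cast hn
  have ha : 0 < α - (n : ℝ) := by linarith
  have hn1 : ((n - 1 : ℕ) : ℝ) = (n : ℝ) - 1 := by
    rw [Nat.cast_sub (by omega)]; simp
  -- exponents
  have hp1 : p - 1 < 0 := by
    have : 2 * ((n : ℝ) - 1) / ((n : ℝ) + α - 2) < 1 := by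
      rw [div_lt_one (by linarith)]; linarith
    linarith
  have ht1 : t - 1 < 0 := by
    have : 2 * (n : ℝ) / ((n : ℝ) + α) < 1 := by
      rw [div_lt_one (by linarith)]; linarith
    linarith
  have hθ0 : θ ≤ 0 := by rw [hθ]; exact (div_neg_of_pos_of_neg one_pos hp1).le
  have hκe : κ = 1 / (t - 1) := by
    rw [hκ, ht']; field_simp [ht1.ne]; ring
  have hκ0 : κ ≤ 0 := by rw [hκe]; exact (div_neg_of_pos_of_neg one_pos ht1).le
  have hs₁e : s₁ = (n : ℝ) + α - 2 + (α - n) * θ := by rw [hs₁, hθ]; ring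
  have hs₂e : s₂ = (n : ℝ) + α + (α - n) * κ := by rw [hs₂, hκ]; ring
  have hs₁0 : 0 ≤ s₁ := by
    rw [hs₁]
    have h1 : (n : ℝ) + α - 2 - ((n : ℝ) - α) / (p - 1)
        = (((n : ℝ) + α - 2) * (1 - p) - (α - n)) / (1 - p) := by
      have : p - 1 ≠ 0 := hp1.ne
      have : 1 - p ≠ 0 := by linarith
      rw [show p - 1 = -(1 - p) by ring]
      field_simp; ring
    rw [h1]
    rw [lt_div_iff₀ (by linarith)] at hp
    apply div_nonneg _ (by linarith)
    nlinarith
  have hs₂0 : 0 ≤ s₂ := by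
    rw [hs₂e, hκe]
    have h1 : (n : ℝ) + α + (α - n) * (1 / (t - 1))
        = (((n : ℝ) + α) * (1 - t) - (α - n)) / (1 - t) := by
      have : 1 - t ≠ 0 := by linarith
      rw [show t - 1 = -(1 - t) by ring]
      field_simp; ring
    rw [h1]
    rw [lt_div_iff₀ (by linarith)] at ht
    apply div_nonneg _ (by linarith)
    nlinarith
  -- kernels
  set a := α - (n : ℝ) with ha_def
  set f1 : Eu n → ℝ := fun x => v x ^ κ * ‖x - xo n‖ ^ (-s₂) with hf1
  set f2 : Eu (n - 1) → ℝ := fun y => u y ^ θ * ‖emb n y - xo n‖ ^ (-s₁) with hf2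
  have hem : Measurable (emb n) := (emb_continuous n).measurable
  have hf1m : Measurable f1 := by
    rw [hf1]; fun_prop
  have hf2m : Measurable f2 := by
    rw [hf2]; fun_prop
  have hU : MeasurableSet (upperHalf n) := (upperHalf_open n).measurableSet
  have hu' : ∀ y, ENNReal.ofReal (u y) =
      ∫⁻ x in upperHalf n, ENNReal.ofReal (f1 x * ‖(id x : Eu n) - emb n y‖ ^ a) := by
    intro y; rw [hu y]; congr 1; funext x; congr 1; simp only [hf1, id]; ring
  have hv' : ∀ x ∈ upperHalf n, ENNReal.ofReal (v x) =
      ∫⁻ y, ENNReal.ofReal (f2 y * ‖emb n y - x‖ ^ a) := by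
    intro x hx; rw [hv x hx]; congr 1; funext y; congr 1; simp only [hf2]
    rw [norm_sub_rev x]; ring
  have hf1pos : ∀ x ∈ upperHalf n, 0 < f1 x := by
    intro x hx
    have h1 := hv0 x hx
    have h2 := upper_norm n (by omega) x hx.le
    have h3 : 0 < ‖x - xo n‖ := upper_norm_pos n (by omega) x hx.le
    simp only [hf1]; positivity
  have hf2pos : ∀ y, 0 < f2 y := by
    intro y
    have h1 := hu0 y
    have h3 : 0 < ‖emb n y - xo n‖ := upper_norm_pos n (by omega) _ (emb_last n y).ge
    simp only [hf2]; positivity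
  -- mass near the origin
  obtain ⟨i1, hi1, hi1'⟩ : ∃ i0 : ℝ, 0 < i0 ∧ ENNReal.ofReal i0 ≤
      ∫⁻ x in {x : Eu n | ‖(id x : Eu n)‖ ≤ 1}, ENNReal.ofReal (f1 x)
        ∂(volume.restrict (upperHalf n)) := by
    apply exists_real_le
    rw [setLIntegral_pos_iff hf1m.ennreal_ofReal]
    have hsub : upperHalf n ∩ ball 0 1 ⊆
        (Function.support (fun x => ENNReal.ofReal (f1 x)) ∩ {x : Eu n | ‖(id x : Eu n)‖ ≤ 1})
          ∩ upperHalf n := by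
      intro x hx
      refine ⟨⟨?_, ?_⟩, hx.1⟩
      · simpa using hf1pos x hx.1
      · have := hx.2
        rw [mem_ball_zero_iff] at this
        exact this.le
    rw [Measure.restrict_apply' hU]
    refine lt_of_lt_of_le ?_ (measure_mono hsub)
    exact ((upperHalf_open n).inter isOpen_ball).measure_pos _ (upper_ball_nonempty n (by omega))
  obtain ⟨i2, hi2, hi2'⟩ : ∃ i0 : ℝ, 0 < i0 ∧ ENNReal.ofReal i0 ≤
      ∫⁻ y in {y : Eu (n - 1) | ‖emb n y‖ ≤ 1}, ENNReal.ofReal (f2 y) := by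
    apply exists_real_le
    rw [setLIntegral_pos_iff hf2m.ennreal_ofReal]
    have hsub : ball 0 1 ⊆ Function.support (fun x => ENNReal.ofReal (f2 x)) ∩
        {y : Eu (n - 1) | ‖emb n y‖ ≤ 1} := by
      intro y hy
      refine ⟨by simpa using hf2pos y, ?_⟩
      rw [mem_ball_zero_iff] at hy
      show ‖emb n y‖ ≤ 1
      rw [emb_norm n (by omega)]
      exact hy.le
    exact lt_of_lt_of_le (measure_ball_pos _ _ one_pos) (measure_mono hsub)
  have hf1ae : ∀ᵐ x ∂(volume.restrict (upperHalf n)), 0 ≤ f1 x := by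
    filter_upwards [ae_restrict_mem hU] with x hx using (hf1pos x hx).le
  -- lower bounds
  have hulow : ∀ y, 2 ≤ ‖emb n y‖ → i1 * (‖emb n y‖ / 2) ^ a ≤ u y := by
    intro y hy
    have := lower_abstract _ n id measurable_id f1 hf1m a i1 ha hi1 hf1ae hi1' (emb n y) hy
    rw [← hu' y] at this
    exact (ENNReal.ofReal_le_ofReal_iff (hu0 y).le).1 this
  have hvlow : ∀ x ∈ upperHalf n, 2 ≤ ‖x‖ → i2 * (‖x‖ / 2) ^ a ≤ v x := by
    intro x hx hx2
    have := lower_abstract volume n (emb n) hem f2 hf2m a i2 ha hi2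
      (Filter.Eventually.of_forall fun y => (hf2pos y).le) hi2' x hx2
    rw [← hv' x hx] at this
    exact (ENNReal.ofReal_le_ofReal_iff (hv0 x hx).le).1 this
  -- application to u
  have hb0 : 0 < min a 1 := lt_min ha one_pos
  have hb1 : min a 1 ≤ 1 := min_le_right _ _
  obtain ⟨Λ1, hΛ1, H1⟩ := moving_abstract (volume.restrict (upperHalf n)) n (by omega) id
    measurable_id f1 hf1m a n ((i2 / 2 ^ a) ^ κ)
    (∫⁻ x : Eu n, ENNReal.ofReal (psi (min a 1) (2 * n + min a 1 - 1) ‖x‖)).toReal i1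
    ha (by linarith) (by positivity) ENNReal.toReal_nonneg hi1
    (by
      filter_upwards [ae_restrict_mem hU] with x hx
      refine ⟨(hf1pos x hx).le, fun hx2 => ?_⟩
      have := decay_bound (X := ‖x‖) (Z := ‖x - xo n‖) (c := i2) (a := a) (k := κ) (s := s₂)
        (v := v x) (by exact lt_of_lt_of_le two_pos hx2) hi2 hκ0 hs₂0
        (upper_norm n (by omega) x hx.le) (hvlow x hx hx2)
      refine this.trans_eq ?_
      congr 2
      rw [hs₂e]; simp only [ha_def]; ring)
    hi1'
    (by
      intro z
      rw [ENNReal.ofReal_toReal (psi_lintegral n (by omega) _ _ hb0 (by linarith))]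
      rw [← psi_lintegral_shift n _ _ z]
      exact setLIntegral_le_lintegral _ _)
  obtain ⟨Λ2, hΛ2, H2⟩ := moving_abstract (volume : Measure (Eu (n - 1))) n (by omega) (emb n)
    hem f2 hf2m a (n - 1 : ℕ) ((i1 / 2 ^ a) ^ θ)
    (∫⁻ x : Eu (n - 1),
      ENNReal.ofReal (psi (min a 1) (2 * (n - 1 : ℕ) + min a 1 - 1) ‖x‖)).toReal i2
    ha (by rw [hn1]; linarith) (by positivity) ENNReal.toReal_nonneg hi2
    (by
      refine Filter.Eventually.of_forall fun y => ?_
      refine ⟨(hf2pos y).le, fun hx2 => ?_⟩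
      have := decay_bound (X := ‖emb n y‖) (Z := ‖emb n y - xo n‖) (c := i1) (a := a) (k := θ)
        (s := s₁) (v := u y) (lt_of_lt_of_le two_pos hx2) hi1 hθ0 hs₁0
        (upper_norm n (by omega) _ (emb_last n y).ge) (hulow y hx2)
      refine this.trans_eq ?_
      congr 2
      rw [hs₁e, hn1]; simp only [ha_def]; ring)
    hi2'
    (by
      intro z
      rw [ENNReal.ofReal_toReal (psi_lintegral (n - 1) (by omega) _ _ hb0
        (by rw [hn1]; linarith))]
      obtain ⟨z', hz'⟩ := emb_proj n (by omega) z
      rw [← psi_lintegral_shift (n - 1) _ _ z']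
      have hne : Nonempty (Fin (n - 1)) := ⟨⟨0, by omega⟩⟩
      have hnt : Nontrivial (Eu (n - 1)) := inferInstance
      apply lintegral_mono_ae
      filter_upwards [Measure.ae_ne volume z'] with y hy
      apply ENNReal.ofReal_le_ofReal
      apply psi_anti hb1 (by rw [hn1]; linarith) (norm_pos_iff.2 (sub_ne_zero.2 hy)) (hz' y))
  refine ⟨min Λ1 Λ2, (min_le_left _ _).trans_lt hΛ1, fun l hl => ⟨fun y hy => ?_, fun x hx hxl => ?_⟩⟩
  · have := H1 l (hl.trans (min_le_left _ _)) (emb n y) (by rw [emb_first n hn]; exact hy)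
    rw [← hu' y, ← emb_refl n hn, ← hu'] at this
    exact (ENNReal.ofReal_le_ofReal_iff (hu0 y).le).1 this
  · have := H2 l (hl.trans (min_le_right _ _)) x hxl
    rw [← hv' x hx, ← hv' _ (refl_mem n hn l x hx)] at this
    exact (ENNReal.ofReal_le_ofReal_iff (hv0 x hx).le).1 this
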